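/- Let 𝒜 be a uniformly complete f-algebra and let p ∈ ℕ with p ≥ 2. If g ∈ Φ₂(𝒜) (g is totally finite in 𝒜), then g^p ∈ Φ₂(Π_p(𝒜)); and if g ∈ Φ₃(𝒜), then g^p ∈ Φ₃(Π_p(𝒜)). If, in addition, 𝒜 is semiprime, then the converse implications also hold: g^p ∈ Φ₂(Π_p(𝒜)) implies g ∈ Φ₂(𝒜), and g^p ∈ Φ₃(Π_p(𝒜)) implies g ∈ Φ₃(𝒜). -/

import Mathlib

namespace FiniteElementsPaper

/-- Product of `p` factors `φ 0 * φ 1 * ⋯ * φ (p-1)` in a (possibly non-unital)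
multiplicative structure; junk value `0` when `p = 0`. -/
def mulProd {A : Type*} [Mul A] [Zero A] : (p : ℕ) → (Fin p → A) → A
  | 0, _ => 0
  | q + 1, φ => Fin.foldl q (fun acc i => acc * φ i.succ) (φ 0)

/-- `p`-th power `a^p` (junk value `0` for `p = 0`). -/
def mpow {A : Type*} [Mul A] [Zero A] (a : A) (p : ℕ) : A :=
  mulProd p (fun _ => a)

/-- The set `Π_p(𝒜)` of all `p`-fold products. -/
def piSet (A : Type*) [Mul A] [Zero A] (p : ℕ) : Set A :=
  {x | ∃ φ : Fin p → A, x = mulProd p φ}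

variable {A : Type*} [Lattice A] [AddCommGroup A] [Module ℝ A]

/-- `z` is a majorant of `φ`: `z ≥ 0` and for every `x` there is `c > 0` with
`|x| ⊓ n • |φ| ≤ c • z` for all `n`. -/
def IsMajorant (z φ : A) : Prop :=
  0 ≤ z ∧ ∀ x : A, ∃ c : ℝ, 0 < c ∧ ∀ n : ℕ, |x| ⊓ n • |φ| ≤ c • z

/-- `φ` is a finite element. -/
def IsFiniteElt (φ : A) : Prop := ∃ z : A, IsMajorant z φ

/-- `φ` is a totally finite element: it has a majorant which is itself finite. -/
def IsTotallyFiniteElt (φ : A) : Prop := ∃ z : A, IsMajorant z φ ∧ IsFiniteElt z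

/-- `φ` is self-majorizing: `|φ|` is a majorant of `φ`. -/
def IsSelfMajorizing (φ : A) : Prop := IsMajorant |φ| φ

/-- `φ ∈ Φ₃(A) = S₊(A) - S₊(A)`. -/
def InPhi3 (φ : A) : Prop :=
  ∃ s t : A, 0 ≤ s ∧ 0 ≤ t ∧ IsSelfMajorizing s ∧ IsSelfMajorizing t ∧ φ = s - t

/-- `w` is a majorant of `φ` relative to the subset `S` (all lattice operations
computed in the ambient algebra). -/
def IsMajorantIn (S : Set A) (w φ : A) : Prop :=
  0 ≤ w ∧ ∀ x ∈ S, ∃ c : ℝ, 0 < c ∧ ∀ n : ℕ, |x| ⊓ n • |φ| ≤ c • w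

/-- `φ` is a finite element of the sublattice `S` (majorant required to lie in `S`). -/
def IsFiniteEltIn (S : Set A) (φ : A) : Prop := ∃ w ∈ S, IsMajorantIn S w φ

/-- `φ` is a totally finite element of the sublattice `S`. -/
def IsTotallyFiniteEltIn (S : Set A) (φ : A) : Prop :=
  ∃ w ∈ S, IsMajorantIn S w φ ∧ IsFiniteEltIn S w

/-- `φ` is self-majorizing in the sublattice `S`. -/
def IsSelfMajorizingIn (S : Set A) (φ : A) : Prop := IsMajorantIn S |φ| φ

/-- `φ ∈ Φ₃(S) = S₊(S) - S₊(S)` for the sublattice `S`. -/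
def InPhi3In (S : Set A) (φ : A) : Prop :=
  ∃ s t : A, s ∈ S ∧ t ∈ S ∧ 0 ≤ s ∧ 0 ≤ t ∧
    IsSelfMajorizingIn S s ∧ IsSelfMajorizingIn S t ∧ φ = s - t

variable (A) in
/-- Archimedean ℓ-algebra structure: an Archimedean vector lattice together with an
associative bilinear multiplication whose product of positive elements is positive. -/
structure IsLAlgebra [Mul A] : Prop where
  add_le_add_left : ∀ a b : A, a ≤ b → ∀ c : A, c + a ≤ c + b
  smul_le_smul : ∀ (r : ℝ) (a b : A), 0 ≤ r → a ≤ b → r • a ≤ r • b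
  archimedean : ∀ a b : A, 0 ≤ a → (∀ n : ℕ, n • a ≤ b) → a = 0
  mul_assoc : ∀ a b c : A, a * b * c = a * (b * c)
  left_distrib : ∀ a b c : A, a * (b + c) = a * b + a * c
  right_distrib : ∀ a b c : A, (a + b) * c = a * c + b * c
  smul_mul : ∀ (r : ℝ) (a b : A), (r • a) * b = r • (a * b)
  mul_smul : ∀ (r : ℝ) (a b : A), a * (r • b) = r • (a * b)
  mul_nonneg : ∀ a b : A, 0 ≤ a → 0 ≤ b → 0 ≤ a * b

variable (A) in
/-- A `d`-algebra: ℓ-algebra in which `a ⊓ b = 0` implies `(a*c) ⊓ (b*c) = (c*a) ⊓ (c*b) = 0`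
for all `c ≥ 0`. -/
structure IsDAlgebra [Mul A] extends IsLAlgebra A : Prop where
  d_prop : ∀ a b c : A, a ⊓ b = 0 → 0 ≤ c → (a * c) ⊓ (b * c) = 0 ∧ (c * a) ⊓ (c * b) = 0

variable (A) in
/-- An `f`-algebra: ℓ-algebra in which `a ⊓ b = 0` implies `(a*c) ⊓ b = (c*a) ⊓ b = 0`
for all `c ≥ 0`. -/
structure IsFAlgebra [Mul A] extends IsLAlgebra A : Prop where
  f_prop : ∀ a b c : A, a ⊓ b = 0 → 0 ≤ c → (a * c) ⊓ b = 0 ∧ (c * a) ⊓ b = 0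

/-- `e` is a multiplicative unit. -/
def IsMulUnit [Mul A] (e : A) : Prop := ∀ a : A, a * e = a ∧ e * a = a

/-- `e` is an order unit. -/
def IsOrderUnit (e : A) : Prop := 0 ≤ e ∧ ∀ x : A, ∃ l : ℝ, 0 ≤ l ∧ |x| ≤ l • e

variable (A) in
/-- The algebra is semiprime: `0` is its only nilpotent element. -/
def IsSemiprime [Mul A] [Zero A] : Prop :=
  ∀ (a : A) (n : ℕ), 0 < n → mpow a n = 0 → a = 0

variable (A) in
/-- The vector lattice is uniformly complete. -/
def UniformlyComplete : Prop :=
  ∀ u : A, 0 ≤ u → ∀ f : ℕ → A,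
    (∀ ε : ℝ, 0 < ε → ∃ K : ℕ, ∀ m n : ℕ, K ≤ m → K ≤ n → |f m - f n| ≤ ε • u) →
    ∃ a : A, ∀ ε : ℝ, 0 < ε → ∃ K : ℕ, ∀ n : ℕ, K ≤ n → |f n - a| ≤ ε • u

variable (A) in
/-- The weak factorization property: every element is dominated by a product. -/
def WeakFactorization [Mul A] : Prop := ∀ a : A, ∃ b c : A, a ≤ b * c


set_option linter.unusedSectionVars false

/-- Two positive elements are disjoint. -/
def Perp {B : Type*} [Lattice B] [Zero B] (a b : B) : Prop := 0 ≤ a ∧ 0 ≤ b ∧ a ⊓ b = 0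

/-- No nonzero positive element has all its multiples bounded. -/
class IsArchimedeanGroup (B : Type*) [Lattice B] [AddCommGroup B] : Prop where
  eq_zero_of_nsmul_le : ∀ a b : B, 0 ≤ a → (∀ n : ℕ, n • a ≤ b) → a = 0

/-- Multiplication by a positive element preserves disjointness from a given element. -/
class IsFRing (B : Type*) [Lattice B] [Zero B] [Mul B] : Prop where
  perp_mul : ∀ a b c : B, a ⊓ b = 0 → 0 ≤ c → (a * c) ⊓ b = 0 ∧ (c * a) ⊓ b = 0

section Group

variable {B : Type*} [Lattice B] [AddCommGroup B] [IsOrderedAddMonoid B] {a b c h : B}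

lemma Perp.symm (hab : Perp a b) : Perp b a := ⟨hab.2.1, hab.1, inf_comm a b ▸ hab.2.2⟩

lemma Perp.mono_left (hbh : Perp b h) (ha : 0 ≤ a) (hab : a ≤ b) : Perp a h :=
  ⟨ha, hbh.2.1, le_antisymm ((inf_le_inf_right h hab).trans hbh.2.2.le) (le_inf ha hbh.2.1)⟩

lemma Perp.mono_right (hah : Perp h b) (ha : 0 ≤ a) (hab : a ≤ b) : Perp h a :=
  (hah.symm.mono_left ha hab).symm

lemma Perp.eq_zero (haa : Perp a a) : a = 0 := by simpa using haa.2.2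

lemma inf_add_le (hb : 0 ≤ b) (hc : 0 ≤ c) (hh : 0 ≤ h) : h ⊓ (b + c) ≤ h ⊓ b + h ⊓ c := by
  rw [add_inf, inf_add, inf_add]
  refine le_inf (le_inf ?_ ?_) (le_inf ?_ inf_le_right)
  · exact inf_le_left.trans (le_add_of_nonneg_left hh)
  · exact inf_le_left.trans (le_add_of_nonneg_left hb)
  · exact inf_le_left.trans (le_add_of_nonneg_right hc)

lemma Perp.add_left (ha : Perp a h) (hb : Perp b h) : Perp (a + b) h := by
  refine ⟨add_nonneg ha.1 hb.1, ha.2.1, le_antisymm ?_ (le_inf (add_nonneg ha.1 hb.1) ha.2.1)⟩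
  rw [inf_comm]
  refine (inf_add_le ha.1 hb.1 ha.2.1).trans ?_
  rw [ha.symm.2.2, hb.symm.2.2, add_zero]

lemma Perp.nsmul_left (ha : Perp a h) (n : ℕ) : Perp (n • a) h := by
  induction n with
  | zero => simpa using ha.mono_left le_rfl ha.1
  | succ n ih => rw [succ_nsmul]; exact ih.add_left ha

lemma Perp.add_le (hab : Perp a b) (ha : a ≤ c) (hb : b ≤ c) : a + b ≤ c := by
  rw [← inf_add_sup a b, hab.2.2, zero_add]
  exact sup_le ha hb

lemma perp_posPart_negPart (x : B) : Perp x⁺ x⁻ :=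
  ⟨posPart_nonneg x, negPart_nonneg x, posPart_inf_negPart_eq_zero x⟩

lemma inf_add_posPart_inf (x y z : B) (hz : 0 ≤ z) :
    x ⊓ y + (x - y)⁺ ⊓ z = x ⊓ (y + z) := by
  rw [add_inf, inf_eq_sub_posPart_sub x y, sub_add_cancel, ← inf_eq_sub_posPart_sub,
    inf_add, ← inf_assoc, inf_eq_left.2 (le_add_of_nonneg_right hz)]

/-- In an Archimedean group, `x` is dominated by `y` on the carrier of `h` precisely when
all truncations `x ⊓ n • h` are. -/
lemma perp_posPart_sub_iff [IsArchimedeanGroup B] {x y : B} (hy : 0 ≤ y)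
    (hh : 0 ≤ h) : Perp (x - y)⁺ h ↔ ∀ n : ℕ, x ⊓ n • h ≤ y := by
  constructor
  · intro H n
    have hn : 0 ≤ n • h := nsmul_nonneg hh n
    have h1 : x ≤ y + (x - y)⁺ := sub_le_iff_le_add'.1 (le_posPart _)
    calc x ⊓ n • h ≤ n • h ⊓ (y + (x - y)⁺) := le_inf inf_le_right (inf_le_left.trans h1)
      _ ≤ n • h ⊓ y + n • h ⊓ (x - y)⁺ := inf_add_le hy (posPart_nonneg _) hn
      _ = n • h ⊓ y := by rw [(H.symm.nsmul_left n).2.2, add_zero]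
      _ ≤ y := inf_le_right
  · intro H
    refine ⟨posPart_nonneg _, hh, ?_⟩
    set u := (x - y)⁺ with hu
    refine IsArchimedeanGroup.eq_zero_of_nsmul_le _ y (le_inf (posPart_nonneg _) hh) fun n => ?_
    have hp : Perp (n • h - y)⁺ u := by
      refine ⟨posPart_nonneg _, posPart_nonneg _, ?_⟩
      rw [hu, posPart_def, posPart_def, ← @sup_inf_right B (AddCommGroup.toDistribLattice B),
        ← inf_sub, sup_eq_right]
      simpa [inf_comm] using H n
    have h1 : n • h ≤ y + (n • h - y)⁺ := sub_le_iff_le_add'.1 (le_posPart _)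
    have hn : 0 ≤ n • u := nsmul_nonneg (posPart_nonneg _) n
    calc n • (u ⊓ h) ≤ n • u ⊓ (y + (n • h - y)⁺) :=
          le_inf (nsmul_le_nsmul_right inf_le_left n)
            ((nsmul_le_nsmul_right inf_le_right n).trans h1)
      _ ≤ n • u ⊓ y + n • u ⊓ (n • h - y)⁺ := inf_add_le hy (posPart_nonneg _) hn
      _ = n • u ⊓ y := by rw [(hp.symm.nsmul_left n).2.2, add_zero]
      _ ≤ y := inf_le_right

end Group

section Ring

variable {B : Type*} [NonUnitalRing B] [Lattice B] [IsOrderedAddMonoid B] [PosMulMono B]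
  [MulPosMono B] [IsFRing B] {a b c h : B}

lemma Perp.mul_right (hah : Perp a h) (hc : 0 ≤ c) : Perp (a * c) h :=
  ⟨mul_nonneg hah.1 hc, hah.2.1, (IsFRing.perp_mul a h c hah.2.2 hc).1⟩

lemma Perp.mul_left (hah : Perp a h) (hc : 0 ≤ c) : Perp (c * a) h :=
  ⟨mul_nonneg hc hah.1, hah.2.1, (IsFRing.perp_mul a h c hah.2.2 hc).2⟩

lemma Perp.mul_eq_zero (hah : Perp a h) : a * h = 0 :=
  ((hah.mul_right hah.2.1).symm.mul_left hah.1).eq_zero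

lemma posPart_mul_negPart (x : B) : x⁺ * x⁻ = 0 := (perp_posPart_negPart x).mul_eq_zero

lemma negPart_mul_posPart (x : B) : x⁻ * x⁺ = 0 := (perp_posPart_negPart x).symm.mul_eq_zero

lemma mul_posPart_self (x : B) : x * x⁺ = x⁺ * x⁺ := by
  nth_rewrite 1 [← posPart_sub_negPart x]
  rw [sub_mul, negPart_mul_posPart, sub_zero]

lemma posPart_mul_self (x : B) : x⁺ * x = x⁺ * x⁺ := by
  nth_rewrite 2 [← posPart_sub_negPart x]
  rw [mul_sub, posPart_mul_negPart, sub_zero]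

lemma abs_mul_eq (x y : B) : |x * y| = |x| * |y| := by
  have e : x * y = (x⁺ * y⁺ + x⁻ * y⁻) - (x⁺ * y⁻ + x⁻ * y⁺) := by
    nth_rewrite 1 [← posPart_sub_negPart x, ← posPart_sub_negPart y]
    noncomm_ring
  have hx := perp_posPart_negPart x
  have hy := perp_posPart_negPart y
  have mm {a b c d : B} (H : Perp a b) (hc : 0 ≤ c) (hd : 0 ≤ d) : Perp (a * c) (b * d) :=
    ((H.mul_right hc).symm.mul_right hd).symm
  have mm' {a b c d : B} (H : Perp a b) (hc : 0 ≤ c) (hd : 0 ≤ d) : Perp (c * a) (d * b) :=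
    ((H.mul_left hc).symm.mul_left hd).symm
  have key : Perp (x⁺ * y⁺ + x⁻ * y⁻) (x⁺ * y⁻ + x⁻ * y⁺) := by
    refine Perp.add_left (Perp.symm (Perp.add_left ?_ ?_)) (Perp.symm (Perp.add_left ?_ ?_))
    · exact (mm' hy hx.1 hx.1).symm
    · exact mm hx.symm hy.1 hy.1
    · exact mm hx hy.2.1 hy.2.1
    · exact mm' hy hx.2.1 hx.2.1
  have abs_sub_of_perp {a b : B} (H : Perp a b) : |a - b| = a + b := by
    have h1 := two_nsmul_inf_eq_add_sub_abs_sub a b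
    rw [H.2.2, smul_zero, abs_sub_comm] at h1
    exact (sub_eq_zero.1 h1.symm).symm
  rw [e, abs_sub_of_perp key, ← posPart_add_negPart x, ← posPart_add_negPart y]
  noncomm_ring

lemma abs_commutator_le (ha : 0 ≤ a) (hb : 0 ≤ b) : |a * b - b * a| ≤ a * b + b * a := by
  have h1 := mul_nonneg ha hb
  have h2 := mul_nonneg hb ha
  rw [abs_le']
  constructor
  · exact (sub_le_self _ h2).trans (le_add_of_nonneg_right h2)
  · rw [neg_sub]
    exact (sub_le_self _ h1).trans (le_add_of_nonneg_left h1)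

lemma abs_commutator_inf_nsmul_le (ha : 0 ≤ a) (hb : 0 ≤ b) (m : ℕ) :
    |a * (b ⊓ m • a) - (b ⊓ m • a) * a| ≤ a * a := by
  induction m with
  | zero => simpa [inf_eq_right.2 hb] using mul_nonneg ha ha
  | succ m ih =>
    set r := (b - m • a)⁺ ⊓ a with hr
    have r0 : 0 ≤ r := le_inf (posPart_nonneg _) ha
    have hrec : b ⊓ (m + 1) • a = b ⊓ m • a + r := by
      rw [succ_nsmul, inf_add_posPart_inf _ _ _ ha]
    have hT : a * (b ⊓ m • a) - (b ⊓ m • a) * a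
        = -(a * (b - m • a)⁻ - (b - m • a)⁻ * a) := by
      have : b ⊓ m • a = m • a - (b - m • a)⁻ := by
        rw [inf_comm, inf_eq_sub_posPart_sub, ← neg_sub b, posPart_neg]
      rw [this, mul_sub, sub_mul, smul_mul_assoc, mul_smul_comm]
      abel
    have hp : Perp |a * (b ⊓ m • a) - (b ⊓ m • a) * a| r := by
      have h0 := perp_posPart_negPart (b - m • a)
      have h1 : Perp (b - m • a)⁻ r := (h0.mono_left r0 inf_le_left).symm
      rw [hT, abs_neg]
      exact ((h1.mul_left ha).add_left (h1.mul_right ha)).mono_left (abs_nonneg _)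
        (abs_commutator_le ha h0.2.1)
    have hp' : Perp |a * (b ⊓ m • a) - (b ⊓ m • a) * a| |a * r - r * a| :=
      (((hp.symm.mul_left ha).add_left (hp.symm.mul_right ha)).mono_left (abs_nonneg _)
        (abs_commutator_le ha r0)).symm
    have hr1 : |a * r - r * a| ≤ a * a := by
      have h1 : a * r ≤ a * a := mul_le_mul_of_nonneg_left inf_le_right ha
      have h2 : r * a ≤ a * a := mul_le_mul_of_nonneg_right inf_le_right ha
      rw [abs_le', neg_sub]
      exact ⟨(sub_le_self _ (mul_nonneg r0 ha)).trans h1,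
        (sub_le_self _ (mul_nonneg ha r0)).trans h2⟩
    have e : a * (b ⊓ (m + 1) • a) - (b ⊓ (m + 1) • a) * a
        = (a * (b ⊓ m • a) - (b ⊓ m • a) * a) + (a * r - r * a) := by
      rw [hrec]; noncomm_ring
    rw [e]
    exact (abs_add_le _ _).trans (hp'.add_le ih hr1)

lemma nsmul_abs_commutator_le [Module ℝ B] [IsScalarTower ℝ B B] [SMulCommClass ℝ B B]
    [IsOrderedModule ℝ B] (ha : 0 ≤ a) (hb : 0 ≤ b) (n : ℕ) :
    n • |a * b - b * a| ≤ a * a + (b * b + b * b) := by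
  rcases Nat.eq_zero_or_pos n with rfl | hn
  · have := mul_nonneg hb hb
    simpa using add_nonneg (mul_nonneg ha ha) (add_nonneg this this)
  set x := n • b with hx
  have x0 : 0 ≤ x := nsmul_nonneg hb n
  set v := (x - (n * n) • a)⁺ with hv
  have v0 : 0 ≤ v := posPart_nonneg _
  have vx : v ≤ x := sup_le (sub_le_self _ (nsmul_nonneg ha _)) x0
  have cancel {y : B} (hy : (n * n) • y ≤ x * x) : y ≤ b * b := by
    have hnn : (0 : ℝ) < ((n * n : ℕ) : ℝ) := by positivity
    rw [hx, smul_mul_smul_comm, ← Nat.cast_smul_eq_nsmul ℝ, ← Nat.cast_smul_eq_nsmul ℝ] at hy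
    exact (smul_le_smul_iff_of_pos_left hnn).1 hy
  have h1 : a * v ≤ b * b := by
    apply cancel
    have : 0 ≤ (x - (n * n) • a) * v := by
      rw [hv, mul_posPart_self]; exact mul_nonneg v0 v0
    rw [sub_mul, sub_nonneg, smul_mul_assoc] at this
    exact this.trans (mul_le_mul_of_nonneg_left vx x0)
  have h2 : v * a ≤ b * b := by
    apply cancel
    have : 0 ≤ v * (x - (n * n) • a) := by
      rw [hv, posPart_mul_self]; exact mul_nonneg v0 v0
    rw [mul_sub, sub_nonneg, mul_smul_comm] at this
    exact this.trans (mul_le_mul_of_nonneg_right vx x0)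
  have e : n • (a * b - b * a) = (a * (x ⊓ (n * n) • a) - (x ⊓ (n * n) • a) * a)
      + (a * v - v * a) := by
    rw [inf_eq_sub_posPart_sub, ← hv, hx, mul_sub, sub_mul, mul_smul_comm, smul_mul_assoc,
      smul_sub]
    abel
  have habs : n • |a * b - b * a| = |n • (a * b - b * a)| := by
    rw [← Nat.cast_smul_eq_nsmul ℝ, ← Nat.cast_smul_eq_nsmul ℝ, abs, abs, ← smul_neg]
    exact (OrderIso.smulRight (Nat.cast_pos.2 hn)).map_sup _ _
  rw [habs, e]
  exact (abs_add_le _ _).trans (add_le_add (abs_commutator_inf_nsmul_le ha x0 _)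
    ((abs_commutator_le ha v0).trans (add_le_add h1 h2)))

/-- Archimedean `f`-algebras are commutative. -/
theorem mul_comm_of_isFRing [Module ℝ B] [IsScalarTower ℝ B B] [SMulCommClass ℝ B B]
    [IsOrderedModule ℝ B] [IsArchimedeanGroup B] (x y : B) : x * y = y * x := by
  have pos {a b : B} (ha : 0 ≤ a) (hb : 0 ≤ b) : a * b = b * a := by
    have := IsArchimedeanGroup.eq_zero_of_nsmul_le _ _ (abs_nonneg _)
      (nsmul_abs_commutator_le ha hb)
    refine sub_eq_zero.1 (le_antisymm ((le_abs_self _).trans this.le) ?_)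
    simpa using (neg_le_abs (a * b - b * a)).trans this.le
  rw [← posPart_sub_negPart x, ← posPart_sub_negPart y]
  simp only [mul_sub, sub_mul, pos (posPart_nonneg x) (posPart_nonneg y),
    pos (posPart_nonneg x) (negPart_nonneg y), pos (negPart_nonneg x) (posPart_nonneg y),
    pos (negPart_nonneg x) (negPart_nonneg y)]
  abel

end Ring

section RealRooted

open Polynomial

lemma neg_one_pow_mul_prod_ge (p i : ℕ) (hi : i ≤ p) :
    (1 / 2 : ℝ) ^ p ≤ (-1) ^ i * ∏ j : Fin p, ((j : ℝ) - i + 1 / 2) := by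
  have hsign : ∏ j : Fin p, (if (j : ℕ) < i then (-1 : ℝ) else 1) = (-1) ^ i := by
    rw [Fin.prod_univ_eq_prod_range (fun j => if j < i then (-1 : ℝ) else 1), Finset.prod_ite,
      Finset.prod_const_one, mul_one, Finset.prod_const]
    congr 1
    have : (Finset.range p).filter (· < i) = Finset.range i := by
      ext j; simp only [Finset.mem_filter, Finset.mem_range]; omega
    rw [this, Finset.card_range]
  rw [← hsign, ← Finset.prod_mul_distrib]
  calc (1 / 2 : ℝ) ^ p = ∏ _j : Fin p, (1 / 2 : ℝ) := by simp
    _ ≤ _ := by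
      refine Finset.prod_le_prod (fun _ _ => by norm_num) fun j _ => ?_
      split_ifs with hj
      · have : (j : ℝ) + 1 ≤ i := by exact_mod_cast hj
        linarith
      · have : (i : ℝ) ≤ j := by exact_mod_cast not_lt.1 hj
        linarith

/-- A constant perturbation of a large multiple of a real-rooted polynomial is real-rooted. -/
lemma exists_prod_X_add_C_eq (p : ℕ) (hp : 0 < p) : ∃ (M : ℝ) (r s : Fin p → ℝ), 0 < M ∧
    (∀ i, |r i| ≤ 1 / 2) ∧ (∀ i, |s i| ≤ 1 / 2) ∧
    C M * ∏ i, (X + C (r i)) = 1 + C M * ∏ i, (X + C (s i)) := by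
  have hp' : (1 : ℝ) ≤ p := by exact_mod_cast hp
  set δ : ℝ := 1 / (2 * p) with hδ
  have δ0 : 0 < δ := by positivity
  have hδp : p * δ = 1 / 2 := by rw [hδ]; field_simp
  set M : ℝ := 2 * (2 / δ) ^ p with hM
  have M0 : 0 < M := by positivity
  set Q : ℝ[X] := ∏ i : Fin p, (X + C ((i : ℝ) * δ)) with hQ
  set f : ℝ[X] := 1 + C M * Q with hf
  let t : ℕ → ℝ := fun i => δ / 2 - i * δ
  have hsign (i : ℕ) (hi : i ≤ p) : 0 < (-1) ^ i * f.eval (t i) := by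
    have h1 : Q.eval (t i) = δ ^ p * ∏ j : Fin p, ((j : ℝ) - i + 1 / 2) := by
      rw [hQ, eval_prod]
      calc _ = ∏ j : Fin p, δ * ((j : ℝ) - i + 1 / 2) :=
            Finset.prod_congr rfl fun j _ => by simp only [eval_add, eval_X, eval_C, t]; ring
        _ = _ := by rw [Finset.prod_mul_distrib]; simp
    have h2 := neg_one_pow_mul_prod_ge p i hi
    have h3 : M * δ ^ p * (1 / 2) ^ p = 2 := by
      rw [hM, mul_assoc, mul_assoc, ← mul_pow, ← mul_pow]
      have : 2 / δ * (δ * (1 / 2)) = 1 := by field_simp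
      rw [this, one_pow, mul_one]
    have h4 : (2 : ℝ) ≤ M * δ ^ p * ((-1) ^ i * ∏ j : Fin p, ((j : ℝ) - i + 1 / 2)) := by
      exact h3.symm.trans_le (mul_le_mul_of_nonneg_left h2 (by positivity))
    have h5 : (-1 : ℝ) ≤ (-1) ^ i := by
      rcases neg_one_pow_eq_or ℝ i with h | h <;> rw [h]; norm_num
    have h6 : (-1) ^ i * f.eval (t i)
        = (-1) ^ i + M * δ ^ p * ((-1) ^ i * ∏ j : Fin p, ((j : ℝ) - i + 1 / 2)) := by
      rw [hf, eval_add, eval_one, eval_mul, eval_C, h1]; ring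
    rw [h6]; linarith
  have tstep (i : ℕ) : t (i + 1) < t i := by simp only [t]; push_cast; linarith
  have tanti : Antitone t := antitone_nat_of_succ_le fun i => (tstep i).le
  have hroot (i : Fin p) : ∃ x ∈ Set.Ioo (t (i + 1)) (t i), f.eval x = 0 := by
    have h1 := hsign i i.2.le
    have h2 := hsign (i + 1) i.2
    have hc : ContinuousOn (fun x => f.eval x) (Set.Icc (t (i + 1)) (t i)) :=
      f.continuous.continuousOn
    rw [pow_succ] at h2
    rcases neg_one_pow_eq_or ℝ (i : ℕ) with h | h <;> rw [h] at h1 h2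
    · exact intermediate_value_Ioo (tstep i).le hc ⟨by linarith, by linarith⟩
    · exact intermediate_value_Ioo' (tstep i).le hc ⟨by linarith, by linarith⟩
  choose x hx hx0 using hroot
  have xinj : StrictAnti x := fun i j hij =>
    (hx j).2.trans_le ((tanti (Nat.succ_le_of_lt hij)).trans (hx i).1.le)
  have monicQ : Q.Monic := monic_prod_of_monic _ _ fun i _ => monic_X_add_C _
  have degQ : Q.degree = p := by simp only [hQ, degree_prod, degree_X_add_C]; simp
  set P : ℝ[X] := ∏ i : Fin p, (X + C (-x i)) with hP
  have monicP : P.Monic := monic_prod_of_monic _ _ fun i _ => monic_X_add_C _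
  have degP : P.degree = p := by simp only [hP, degree_prod, degree_X_add_C]; simp
  refine ⟨M, fun i => -x i, fun i => i * δ, M0, fun i => ?_, fun i => ?_, ?_⟩
  · have h1 := hx i
    have h2 : t p ≤ t (i + 1) := tanti i.2
    have h3 : t i ≤ t 0 := tanti (Nat.zero_le _)
    have h4 : t p = δ / 2 - 1 / 2 := by simp only [t]; rw [hδp]
    have h5 : t 0 = δ / 2 := by simp [t]
    have h6 : δ ≤ 1 / 2 := by rw [← hδp]; nlinarith
    rw [abs_neg, abs_le]
    constructor <;> linarith [h1.1, h1.2]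
  · have h1 : (i : ℝ) ≤ p := by exact_mod_cast i.2.le
    rw [abs_of_nonneg (by positivity), ← hδp]
    exact mul_le_mul_of_nonneg_right h1 δ0.le
  · change C M * P = f
    refine (Polynomial.eq_of_degree_sub_lt_of_eval_index_eq Finset.univ (v := x)
      xinj.injective.injOn ?_ fun i _ => ?_).symm
    · have h1 : f - C M * P = 1 + C M * (Q - P) := by rw [hf]; ring
      have h2 : (Q - P).degree < p := by
        rw [← degQ]
        exact degree_sub_lt_left (degQ.trans degP.symm) monicQ.ne_zero
          (monicQ.leadingCoeff.trans monicP.leadingCoeff.symm)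
      rw [h1, Finset.card_univ, Fintype.card_fin]
      refine (degree_add_le _ _).trans_lt (max_lt ?_ ?_)
      · rw [degree_one]; exact_mod_cast hp
      · rw [degree_C_mul M0.ne']; exact h2
    · rw [hx0 i, eval_mul, hP, eval_prod, Finset.prod_eq_zero (Finset.mem_univ i), mul_zero]
      simp

lemma aeval_homogenize_prod {R : Type*} [CommRing R] [Algebra ℝ R] (a b : R) {p : ℕ}
    (r : Fin p → ℝ) :
    MvPolynomial.aeval ![a, b] ((∏ i, (X + C (r i)) : ℝ[X]).homogenize p)
      = ∏ i, (a + r i • b) := by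
  have h := homogenize_finsetProd (s := Finset.univ) (p := fun i : Fin p => X + C (r i))
    (n := fun _ => 1) (fun i _ => by simp)
  simp only [Finset.sum_const, Finset.card_univ, Fintype.card_fin, smul_eq_mul, mul_one] at h
  rw [h, map_prod]
  refine Finset.prod_congr rfl fun i _ => ?_
  rw [homogenize_add, homogenize_X one_ne_zero, homogenize_C]
  simp [Algebra.smul_def]

lemma prod_add_smul_eq {R : Type*} [CommRing R] [Algebra ℝ R] (a b : R) {p : ℕ} {M : ℝ}
    {r s : Fin p → ℝ}
    (h : C M * ∏ i, (X + C (r i)) = 1 + C M * ∏ i, (X + C (s i))) :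
    M • ∏ i, (a + r i • b) = b ^ p + M • ∏ i, (a + s i • b) := by
  have h1 := congrArg (fun f : ℝ[X] => MvPolynomial.aeval ![a, b] (f.homogenize p)) h
  simpa [homogenize_add, homogenize_C_mul, aeval_homogenize_prod, homogenize_one,
    ← Algebra.smul_def] using h1

end RealRooted

section Products

variable {B : Type*} [NonUnitalRing B] {q : ℕ}

lemma mulProd_one (φ : Fin 1 → B) : mulProd 1 φ = φ 0 := by simp [mulProd]

lemma mulProd_succ (φ : Fin (q + 2) → B) :
    mulProd (q + 2) φ = mulProd (q + 1) (fun i => φ i.castSucc) * φ (Fin.last _) := by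
  simp only [mulProd, Fin.foldl_succ_last]
  rfl

lemma mpow_one (a : B) : mpow a 1 = a := mulProd_one _

lemma mpow_succ (a : B) : mpow a (q + 2) = mpow a (q + 1) * a := mulProd_succ _

lemma mpow_mem_piSet (a : B) (p : ℕ) : mpow a p ∈ piSet B p := ⟨_, rfl⟩

lemma mulProd_smul [Module ℝ B] [IsScalarTower ℝ B B] [SMulCommClass ℝ B B] (c : ℝ)
    (φ : Fin (q + 1) → B) :
    mulProd (q + 1) (fun i => c • φ i) = c ^ (q + 1) • mulProd (q + 1) φ := by
  induction q with
  | zero => simp [mulProd_one]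
  | succ q ih => rw [mulProd_succ, ih, mulProd_succ, smul_mul_smul_comm, pow_succ c (q + 1)]

lemma mpow_smul [Module ℝ B] [IsScalarTower ℝ B B] [SMulCommClass ℝ B B] (c : ℝ) (a : B) :
    mpow (c • a) (q + 1) = c ^ (q + 1) • mpow a (q + 1) := mulProd_smul c fun _ => a

lemma smul_mem_piSet [Module ℝ B] [IsScalarTower ℝ B B] [SMulCommClass ℝ B B] {c : ℝ}
    (hc : 0 ≤ c) {x : B} (hx : x ∈ piSet B (q + 1)) : c • x ∈ piSet B (q + 1) := by
  obtain ⟨φ, rfl⟩ := hx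
  exact ⟨fun i => c ^ (((q + 1 : ℕ) : ℝ)⁻¹) • φ i, by
    rw [mulProd_smul, Real.rpow_inv_natCast_pow hc q.succ_ne_zero]⟩

variable [Lattice B] [PosMulMono B] [MulPosMono B]

lemma mulProd_nonneg {φ : Fin (q + 1) → B} (hφ : ∀ i, 0 ≤ φ i) : 0 ≤ mulProd (q + 1) φ := by
  induction q with
  | zero => simpa [mulProd_one] using hφ 0
  | succ q ih => rw [mulProd_succ]; exact mul_nonneg (ih fun i => hφ _) (hφ _)

lemma mpow_nonneg {a : B} (ha : 0 ≤ a) : 0 ≤ mpow a (q + 1) := mulProd_nonneg fun _ => ha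

lemma mulProd_le_mulProd {φ ψ : Fin (q + 1) → B} (hφ : ∀ i, 0 ≤ φ i) (h : ∀ i, φ i ≤ ψ i) :
    mulProd (q + 1) φ ≤ mulProd (q + 1) ψ := by
  induction q with
  | zero => simpa [mulProd_one] using h 0
  | succ q ih =>
    rw [mulProd_succ, mulProd_succ]
    exact (mul_le_mul_of_nonneg_left (h _) (mulProd_nonneg fun i => hφ _)).trans
      (mul_le_mul_of_nonneg_right (ih (fun i => hφ _) fun i => h _) ((hφ _).trans (h _)))

lemma mpow_le_mpow {a b : B} (ha : 0 ≤ a) (hab : a ≤ b) : mpow a (q + 1) ≤ mpow b (q + 1) :=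
  mulProd_le_mulProd (fun _ => ha) fun _ => hab

variable [IsOrderedAddMonoid B] [IsFRing B]

lemma abs_mulProd (φ : Fin (q + 1) → B) :
    |mulProd (q + 1) φ| = mulProd (q + 1) fun i => |φ i| := by
  induction q with
  | zero => simp [mulProd_one]
  | succ q ih => rw [mulProd_succ, abs_mul_eq, ih, mulProd_succ]

lemma abs_mpow (a : B) : |mpow a (q + 1)| = mpow |a| (q + 1) := abs_mulProd _

lemma exists_le_of_family (φ : Fin (q + 1) → B) : ∃ W : B, 0 ≤ W ∧ ∀ i, |φ i| ≤ W :=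
  ⟨∑ i, |φ i|, Finset.sum_nonneg fun _ _ => abs_nonneg _, fun i =>
    Finset.single_le_sum (f := fun i => |φ i|) (fun _ _ => abs_nonneg _) (Finset.mem_univ i)⟩

lemma exists_abs_le_mpow {x : B} (hx : x ∈ piSet B (q + 1)) :
    ∃ W : B, 0 ≤ W ∧ |x| ≤ mpow W (q + 1) := by
  obtain ⟨φ, rfl⟩ := hx
  obtain ⟨W, hW, hφ⟩ := exists_le_of_family φ
  exact ⟨W, hW, abs_mulProd φ ▸ mulProd_le_mulProd (fun i => abs_nonneg _) hφ⟩

lemma Perp.mpow_left {a h : B} (hah : Perp a h) : Perp (mpow a (q + 1)) h := by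
  cases q with
  | zero => rwa [mpow_one]
  | succ q => rw [mpow_succ]; exact hah.mul_left (mpow_nonneg hah.1)

lemma Perp.mpow_add_sub {b d h : B} (hdh : Perp d h) (hb : 0 ≤ b) :
    Perp (mpow (b + d) (q + 1) - mpow b (q + 1)) h := by
  induction q with
  | zero => simpa [mpow_one] using hdh
  | succ q ih =>
    have e : mpow (b + d) (q + 2) - mpow b (q + 2)
        = (mpow (b + d) (q + 1) - mpow b (q + 1)) * (b + d) + mpow b (q + 1) * d := by
      rw [mpow_succ, mpow_succ]; noncomm_ring
    rw [e]
    exact (ih.mul_right (add_nonneg hb hdh.1)).add_left (hdh.mul_left (mpow_nonneg hb))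

lemma Perp.mpow_sub_mpow {a b h : B} (H : Perp (a - b)⁺ h) (ha : 0 ≤ a) (hb : 0 ≤ b) :
    Perp (mpow a (q + 1) - mpow b (q + 1))⁺ h := by
  have h1 := H.mpow_add_sub (q := q) hb
  refine h1.mono_left (posPart_nonneg _) (sup_le ?_ h1.1)
  exact sub_le_sub_right (mpow_le_mpow ha (sub_le_iff_le_add'.1 (le_posPart _))) _

lemma mpow_add_mpow_le {b d : B} (hb : 0 ≤ b) (hd : 0 ≤ d) :
    mpow b (q + 1) + mpow d (q + 1) ≤ mpow (b + d) (q + 1) := by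
  induction q with
  | zero => simp [mpow_one]
  | succ q ih =>
    simp only [mpow_succ]
    refine le_trans ?_ (mul_le_mul_of_nonneg_right ih (add_nonneg hb hd))
    rw [add_mul, mul_add, mul_add, add_assoc]
    refine add_le_add_right ?_ _
    rw [← add_assoc]
    exact le_add_of_nonneg_left (add_nonneg (mul_nonneg (mpow_nonneg hb) hd)
      (mul_nonneg (mpow_nonneg hd) hb))

end Products

section Semiprime

variable {B : Type*} [NonUnitalCommRing B] [Lattice B] [IsOrderedAddMonoid B] [PosMulMono B]
  [MulPosMono B] [IsFRing B] {q : ℕ} {a b c h : B}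

lemma mpow_posPart_sub_le (hb : 0 ≤ b) :
    mpow (a - b)⁺ (q + 2) ≤ (mpow a (q + 1) - mpow b (q + 1))⁺ * (a - b)⁺ := by
  set d := (a - b)⁺ with hd
  have d0 : 0 ≤ d := posPart_nonneg _
  have h1 : a * d = (b + d) * d := by
    have := mul_posPart_self (a - b)
    rw [← hd, sub_mul, sub_eq_iff_eq_add] at this
    rw [this, add_mul, add_comm]
  have h2 (n : ℕ) : mpow a (n + 1) * d = mpow (b + d) (n + 1) * d := by
    induction n with
    | zero => simpa [mpow_one] using h1
    | succ n ih =>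
      rw [mpow_succ, mpow_succ, mul_assoc, h1, mul_comm (b + d) d, ← mul_assoc, ih, mul_assoc,
        mul_assoc, mul_comm d]
  calc mpow d (q + 2) = mpow d (q + 1) * d := mpow_succ d
    _ ≤ (mpow (b + d) (q + 1) - mpow b (q + 1)) * d :=
        mul_le_mul_of_nonneg_right (le_sub_iff_add_le'.2 (mpow_add_mpow_le hb d0)) d0
    _ = (mpow a (q + 1) - mpow b (q + 1)) * d := by rw [sub_mul, sub_mul, h2]
    _ ≤ _ := mul_le_mul_of_nonneg_right (le_posPart _) d0

lemma eq_zero_of_perp_mpow (hB : IsSemiprime B) (H : Perp (mpow a (q + 1)) a) : a = 0 :=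
  hB a (q + 1) q.succ_pos (H.symm.mpow_left).eq_zero

lemma Perp.of_mpow_sub_mpow (hB : IsSemiprime B)
    (H : Perp (mpow a (q + 1) - mpow b (q + 1))⁺ h) (hb : 0 ≤ b) : Perp (a - b)⁺ h := by
  have d0 : 0 ≤ (a - b)⁺ := posPart_nonneg _
  have i0 : 0 ≤ (a - b)⁺ ⊓ h := le_inf d0 H.2.1
  refine ⟨d0, H.2.1, eq_zero_of_perp_mpow (q := q + 1) hB ?_⟩
  exact ((H.mul_right d0).mono_left (mpow_nonneg i0)
    ((mpow_le_mpow i0 inf_le_left).trans (mpow_posPart_sub_le hb))).mono_right i0 inf_le_right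

lemma Perp.of_mpow_right (hB : IsSemiprime B) (H : Perp a (mpow h (q + 1))) (hh : 0 ≤ h) :
    Perp a h := by
  have i0 : 0 ≤ a ⊓ h := le_inf H.1 hh
  exact ⟨H.1, hh, eq_zero_of_perp_mpow (q := q) hB
    ((H.mono_right (mpow_nonneg i0) (mpow_le_mpow i0 inf_le_right)).symm.mono_right i0 inf_le_left)⟩

lemma mulProd_le_mul_mpow {φ : Fin (q + 2) → B} {W : B} (hφ : ∀ i, 0 ≤ φ i)
    (hW : ∀ i, φ i ≤ W) (i : Fin (q + 2)) : mulProd (q + 2) φ ≤ φ i * mpow W (q + 1) := by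
  have W0 : 0 ≤ W := (hφ 0).trans (hW 0)
  induction q with
  | zero =>
    rw [mulProd_succ, mulProd_one, mpow_one]
    refine Fin.lastCases ?_ (fun j => ?_) i
    · rw [mul_comm]; exact mul_le_mul_of_nonneg_left (hW _) (hφ _)
    · rw [Subsingleton.elim j 0]; exact mul_le_mul_of_nonneg_left (hW _) (hφ _)
  | succ q ih =>
    rw [mulProd_succ]
    refine Fin.lastCases ?_ (fun j => ?_) i
    · rw [mul_comm]
      exact mul_le_mul_of_nonneg_left (mulProd_le_mulProd (fun i => hφ _) fun i => hW _) (hφ _)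
    · rw [mpow_succ, ← mul_assoc]
      exact (mul_le_mul_of_nonneg_right (ih (fun i => hφ _) (fun i => hW _) j) (hφ _)).trans
        (mul_le_mul_of_nonneg_left (hW _) (mul_nonneg (hφ _) (mpow_nonneg W0)))

variable [Module ℝ B] [IsScalarTower ℝ B B] [SMulCommClass ℝ B B] [IsOrderedModule ℝ B]

lemma Perp.of_mpow_sub_mulProd (hB : IsSemiprime B) {φ : Fin (q + 2) → B} {W : B} {r : ℝ}
    (hr : 0 ≤ r) (hφ : ∀ i, 0 ≤ φ i) (hW : ∀ i, φ i ≤ W)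
    (H : Perp (mpow W (q + 2) - r • mulProd (q + 2) φ)⁺ h) (i : Fin (q + 2)) :
    Perp (W - r • φ i)⁺ h := by
  have W0 : 0 ≤ W := (hφ 0).trans (hW 0)
  have hP : 0 ≤ mpow W (q + 1) := mpow_nonneg W0
  set d := (W - r • φ i)⁺ with hd
  have d0 : 0 ≤ d := posPart_nonneg _
  have dW : d ≤ W := sup_le (sub_le_self _ (smul_nonneg hr (hφ i))) W0
  have i0 : 0 ≤ d ⊓ h := le_inf d0 H.2.1
  have key : mpow W (q + 1) * d * d ≤ (mpow W (q + 2) - r • mulProd (q + 2) φ)⁺ * d := by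
    have e : mpow W (q + 1) * d * d = (mpow W (q + 2) - r • (φ i * mpow W (q + 1))) * d := by
      rw [mul_assoc, hd, ← mul_posPart_self, ← mul_assoc, mpow_succ, mul_sub, mul_smul_comm,
        mul_comm (φ i)]
    rw [e]
    refine mul_le_mul_of_nonneg_right (le_trans (sub_le_sub_left ?_ _) (le_posPart _)) d0
    exact smul_le_smul_of_nonneg_left (mulProd_le_mul_mpow hφ hW i) hr
  have hle : mpow (d ⊓ h) (q + 3) ≤ mpow W (q + 1) * d * d := by
    rw [mpow_succ, mpow_succ]
    have h1 : mpow (d ⊓ h) (q + 1) ≤ mpow W (q + 1) := mpow_le_mpow i0 (inf_le_left.trans dW)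
    have h2 : mpow (d ⊓ h) (q + 1) * (d ⊓ h) ≤ mpow W (q + 1) * d :=
      (mul_le_mul_of_nonneg_right h1 i0).trans (mul_le_mul_of_nonneg_left inf_le_left hP)
    exact (mul_le_mul_of_nonneg_right h2 i0).trans
      (mul_le_mul_of_nonneg_left inf_le_left (mul_nonneg hP d0))
  refine ⟨d0, H.2.1, eq_zero_of_perp_mpow (q := q + 2) hB ?_⟩
  exact ((H.mul_right d0).mono_left (mpow_nonneg i0) (hle.trans key)).mono_right i0 inf_le_right

end Semiprime

section Majorants

variable {B : Type*} [Lattice B] [AddCommGroup B] [IsOrderedAddMonoid B] [Module ℝ B]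
  [IsOrderedModule ℝ B] [IsArchimedeanGroup B] {S : Set B} {g u v w z φ : B}

lemma isMajorant_iff_univ : IsMajorant z φ ↔ IsMajorantIn Set.univ z φ := by
  simp [IsMajorant, IsMajorantIn]

/-- `w` majorizes `φ` when every element is dominated by a multiple of `w` on the carrier
of `φ`. -/
lemma isMajorantIn_iff (hw : 0 ≤ w) :
    IsMajorantIn S w φ ↔ ∀ x ∈ S, ∃ c : ℝ, 0 < c ∧ Perp (|x| - c • w)⁺ |φ| := by
  rw [IsMajorantIn, and_iff_right hw]
  refine forall₂_congr fun x _ => exists_congr fun c => and_congr_right fun hc => ?_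
  rw [perp_posPart_sub_iff (smul_nonneg hc.le hw) (abs_nonneg φ)]

lemma isMajorant_of_forall_nonneg (hz : 0 ≤ z)
    (H : ∀ x : B, 0 ≤ x → ∃ c : ℝ, 0 < c ∧ Perp (x - c • z)⁺ |φ|) : IsMajorant z φ :=
  isMajorant_iff_univ.2 ((isMajorantIn_iff hz).2 fun x _ => H |x| (abs_nonneg x))

lemma Perp.posPart_sub_mono {x y h : B} (H : Perp (g - y)⁺ h) (hx : x ≤ g) (hy : y ≤ z) :
    Perp (x - z)⁺ h :=
  H.mono_left (posPart_nonneg _) (posPart_mono (sub_le_sub hx hy))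

lemma IsSelfMajorizingIn.of_comparable (hu : IsSelfMajorizingIn S u) (hu0 : 0 ≤ u) {x : B}
    (hx0 : 0 ≤ x) {N : ℕ} (hxu : x ≤ N • u) {K : ℝ} (hK : 0 < K) (hux : u ≤ K • x) :
    IsSelfMajorizingIn S x := by
  rw [IsSelfMajorizingIn, abs_of_nonneg hu0, isMajorantIn_iff hu0, abs_of_nonneg hu0] at hu
  rw [IsSelfMajorizingIn, abs_of_nonneg hx0, isMajorantIn_iff hx0, abs_of_nonneg hx0]
  intro y hy
  obtain ⟨c, hc, H⟩ := hu y hy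
  refine ⟨c * K, mul_pos hc hK, ?_⟩
  have h1 : Perp (|y| - (c * K) • x)⁺ u :=
    H.posPart_sub_mono le_rfl (mul_smul c K x ▸ smul_le_smul_of_nonneg_left hux hc.le)
  exact (h1.symm.nsmul_left N).symm.mono_right hx0 hxu

lemma IsSelfMajorizingIn.add (hu : IsSelfMajorizingIn S u) (hv : IsSelfMajorizingIn S v)
    (hu0 : 0 ≤ u) (hv0 : 0 ≤ v) : IsSelfMajorizingIn S (u + v) := by
  have hw0 := add_nonneg hu0 hv0
  rw [IsSelfMajorizingIn, abs_of_nonneg hu0, isMajorantIn_iff hu0, abs_of_nonneg hu0] at hu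
  rw [IsSelfMajorizingIn, abs_of_nonneg hv0, isMajorantIn_iff hv0, abs_of_nonneg hv0] at hv
  rw [IsSelfMajorizingIn, abs_of_nonneg hw0, isMajorantIn_iff hw0, abs_of_nonneg hw0]
  intro y hy
  obtain ⟨c, hc, H⟩ := hu y hy
  obtain ⟨d, hd, H'⟩ := hv y hy
  refine ⟨c + d, add_pos hc hd, ((Perp.add_left (Perp.symm ?_) (Perp.symm ?_))).symm⟩
  · refine H.posPart_sub_mono le_rfl ?_
    rw [add_smul, smul_add]
    exact (le_add_of_nonneg_right (smul_nonneg hc.le hv0)).trans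
      (le_add_of_nonneg_right (smul_nonneg hd.le hw0))
  · refine H'.posPart_sub_mono le_rfl ?_
    rw [add_smul, smul_add d]
    exact (le_add_of_nonneg_left (smul_nonneg hd.le hu0)).trans
      (le_add_of_nonneg_left (smul_nonneg hc.le hw0))

lemma isSelfMajorizing_iff_univ : IsSelfMajorizing u ↔ IsSelfMajorizingIn Set.univ u :=
  isMajorant_iff_univ

lemma inPhi3_of_abs_le (hu : IsSelfMajorizing u) (hu0 : 0 ≤ u) {N : ℕ} (hg : |g| ≤ N • u) :
    InPhi3 g := by
  have hN : (0 : B) ≤ (N + 1) • u := nsmul_nonneg hu0 _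
  have hlow : u ≤ g + (N + 1) • u := by
    have h : 0 ≤ N • u + g := by
      rw [← sub_neg_eq_add]; exact sub_nonneg.2 ((neg_le_abs g).trans hg)
    rw [succ_nsmul, ← add_assoc, add_comm g]
    exact le_add_of_nonneg_left h
  have hup : g + (N + 1) • u ≤ (N + (N + 1)) • u := by
    rw [add_smul N (N + 1) u]; exact add_le_add_left ((le_abs_self g).trans hg) _
  rw [isSelfMajorizing_iff_univ] at hu
  refine ⟨g + (N + 1) • u, (N + 1) • u, hu0.trans hlow, hN, ?_, ?_, by abel⟩
  · exact isSelfMajorizing_iff_univ.2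
      (hu.of_comparable hu0 (hu0.trans hlow) hup one_pos (by rwa [one_smul]))
  · refine isSelfMajorizing_iff_univ.2 (hu.of_comparable hu0 hN le_rfl one_pos ?_)
    rw [one_smul, succ_nsmul]
    exact le_add_of_nonneg_left (nsmul_nonneg hu0 N)

lemma smul_le_smul_abs (r : ℝ) (x : B) : r • x ≤ |r| • |x| := by
  rcases le_total 0 r with h | h
  · rw [abs_of_nonneg h]; exact smul_le_smul_of_nonneg_left (le_abs_self x) h
  · rw [abs_of_nonpos h, ← neg_smul_neg]
    exact smul_le_smul_of_nonneg_left (neg_le_abs x) (neg_nonneg.2 h)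

/-- A positive finite family has a positive lower bound that is close to its infimum. -/
lemma exists_lowerBound {q : ℕ} (φ : Fin (q + 1) → B) (hφ : ∀ i, 0 ≤ φ i) :
    ∃ z : B, 0 ≤ z ∧ (∀ i, z ≤ φ i) ∧ ∀ (W h : B) (c : ℝ), 0 < c →
      (∀ i, Perp (W - c • φ i)⁺ h) → Perp (W - c • z)⁺ h := by
  induction q with
  | zero => exact ⟨φ 0, hφ 0, fun i => (congrArg φ (Fin.fin_one_eq_zero i)).ge, fun W h c _ H => H 0⟩
  | succ q ih =>
    obtain ⟨z, hz, hle, H⟩ := ih (fun i => φ i.castSucc) fun i => hφ _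
    refine ⟨z ⊓ φ (Fin.last _), le_inf hz (hφ _), fun i => ?_, fun W h c hc hi => ?_⟩
    · exact Fin.lastCases inf_le_right (fun j => inf_le_left.trans (hle j)) i
    · refine ((H W h c hc fun i => hi _).add_left (hi (Fin.last _))).mono_left
        (posPart_nonneg _) ?_
      have e : c • (z ⊓ φ (Fin.last _)) = c • z ⊓ c • φ (Fin.last _) :=
        (OrderIso.smulRight hc).map_inf _ _
      rw [e, sub_inf]
      refine sup_le (sup_le ?_ ?_) (add_nonneg (posPart_nonneg _) (posPart_nonneg _))
      · exact (le_posPart _).trans (le_add_of_nonneg_right (posPart_nonneg _))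
      · exact (le_posPart _).trans (le_add_of_nonneg_left (posPart_nonneg _))

end Majorants

section Powers

variable {B : Type*} [NonUnitalCommRing B] [Lattice B] [IsOrderedAddMonoid B] [PosMulMono B]
  [MulPosMono B] [IsFRing B] [Module ℝ B] [IsScalarTower ℝ B B] [SMulCommClass ℝ B B]
  [IsOrderedModule ℝ B] [IsArchimedeanGroup B] {q : ℕ} {g z φ : B}

lemma IsMajorant.mpow (H : IsMajorant z φ) :
    IsMajorantIn (piSet B (q + 1)) (mpow z (q + 1)) (mpow φ (q + 1)) := by
  have hz := H.1
  rw [isMajorant_iff_univ, isMajorantIn_iff hz] at H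
  refine (isMajorantIn_iff (mpow_nonneg hz)).2 fun x hx => ?_
  obtain ⟨W, hW, hxW⟩ := exists_abs_le_mpow hx
  obtain ⟨c, hc, hp⟩ := H W trivial
  rw [abs_of_nonneg hW] at hp
  refine ⟨c ^ (q + 1), pow_pos hc _, ?_⟩
  rw [abs_mpow, ← mpow_smul]
  exact ((hp.mpow_sub_mpow hW (smul_nonneg hc.le hz)).posPart_sub_mono hxW le_rfl).symm.mpow_left.symm

lemma IsTotallyFiniteElt.mpow (H : IsTotallyFiniteElt g) :
    IsTotallyFiniteEltIn (piSet B (q + 1)) (mpow g (q + 1)) := by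
  obtain ⟨z, hz, y, hy⟩ := H
  exact ⟨_, mpow_mem_piSet z _, hz.mpow, _, mpow_mem_piSet y _, hy.mpow⟩

lemma IsSelfMajorizing.mpow (H : IsSelfMajorizing φ) :
    IsSelfMajorizingIn (piSet B (q + 1)) (mpow φ (q + 1)) := by
  rw [IsSelfMajorizingIn, abs_mpow]
  exact IsMajorant.mpow H

lemma inr_mulProd (φ : Fin (q + 1) → B) :
    ((mulProd (q + 1) φ : B) : Unitization ℝ B) = ∏ i, (φ i : Unitization ℝ B) := by
  induction q with
  | zero => simp [mulProd_one]
  | succ q ih => rw [Fin.prod_univ_castSucc, mulProd_succ, Unitization.inr_mul, ih]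

lemma InPhi3.mpow (H : InPhi3 g) : InPhi3In (piSet B (q + 1)) (mpow g (q + 1)) := by
  obtain ⟨s, t, hs0, ht0, hs, ht, rfl⟩ := H
  set g := s - t with hg
  set u := s + t with hu
  have hu0 : 0 ≤ u := add_nonneg hs0 ht0
  have hus : IsSelfMajorizing u := isSelfMajorizing_iff_univ.2
    ((isSelfMajorizing_iff_univ.1 hs).add (isSelfMajorizing_iff_univ.1 ht) hs0 ht0)
  have hgu : |g| ≤ u := by
    rw [abs_le', hg, neg_sub]
    exact ⟨(sub_le_self _ ht0).trans (le_add_of_nonneg_right ht0),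
      (sub_le_self _ hs0).trans (le_add_of_nonneg_left hs0)⟩
  have hup := hus.mpow (q := q)
  obtain ⟨M, r, r', hM, hr, hr', hpoly⟩ := exists_prod_X_add_C_eq (q + 1) q.succ_pos
  have hbound {ρ : ℝ} (hρ : |ρ| ≤ 1 / 2) : (1 / 2 : ℝ) • u ≤ u + ρ • g ∧
      u + ρ • g ≤ (3 / 2 : ℝ) • u := by
    have key {σ : ℝ} (hσ : |σ| ≤ 1 / 2) : σ • g ≤ (1 / 2 : ℝ) • u :=
      (smul_le_smul_abs σ g).trans ((smul_le_smul_of_nonneg_right hσ (abs_nonneg g)).trans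
        (smul_le_smul_of_nonneg_left hgu (by norm_num)))
    have h1 : u = (1 / 2 : ℝ) • u + (1 / 2 : ℝ) • u := by rw [← add_smul]; norm_num
    constructor
    · have h2 := key (σ := -ρ) (by rwa [abs_neg])
      rw [neg_smul, neg_le_iff_add_nonneg] at h2
      nth_rewrite 2 [h1]
      rw [add_assoc, add_comm _ (ρ • g)]
      exact le_add_of_nonneg_right (by rwa [add_comm] at h2)
    · have h3 : (3 / 2 : ℝ) • u = u + (1 / 2 : ℝ) • u := by
        nth_rewrite 2 [← one_smul ℝ u]; rw [← add_smul]; norm_num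
      rw [h3]; exact add_le_add_right (key hρ) _
  have hhalf : (0 : B) ≤ (1 / 2 : ℝ) • u := smul_nonneg (by norm_num) hu0
  have hself {ρ : Fin (q + 1) → ℝ} (hρ : ∀ i, |ρ i| ≤ 1 / 2) :
      0 ≤ M • mulProd (q + 1) (fun i => u + ρ i • g) ∧
      IsSelfMajorizingIn (piSet B (q + 1)) (M • mulProd (q + 1) fun i => u + ρ i • g) := by
    have h0 (i) : 0 ≤ u + ρ i • g := hhalf.trans (hbound (hρ i)).1
    have h1 : (1 / 2 : ℝ) ^ (q + 1) • FiniteElementsPaper.mpow u (q + 1)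
        ≤ mulProd (q + 1) fun i => u + ρ i • g := by
      rw [← mpow_smul]
      exact mulProd_le_mulProd (fun _ => hhalf) fun i => (hbound (hρ i)).1
    have h2 : (mulProd (q + 1) fun i => u + ρ i • g)
        ≤ (3 / 2 : ℝ) ^ (q + 1) • FiniteElementsPaper.mpow u (q + 1) := by
      rw [← mpow_smul]
      exact mulProd_le_mulProd h0 fun i => (hbound (hρ i)).2
    have hpos := smul_nonneg hM.le (mulProd_nonneg h0)
    have hK : 0 < M * (1 / 2 : ℝ) ^ (q + 1) := by positivity
    refine ⟨hpos, hup.of_comparable (mpow_nonneg hu0) hpos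
      (N := ⌈M * (3 / 2 : ℝ) ^ (q + 1)⌉₊) ?_ (inv_pos.2 hK) ?_⟩
    · rw [← Nat.cast_smul_eq_nsmul ℝ]
      refine (smul_le_smul_of_nonneg_left h2 hM.le).trans ?_
      rw [smul_smul]
      exact smul_le_smul_of_nonneg_right (Nat.le_ceil _) (mpow_nonneg hu0)
    · rw [le_inv_smul_iff_of_pos hK, mul_smul]
      exact smul_le_smul_of_nonneg_left h1 hM.le
  refine ⟨_, _, smul_mem_piSet hM.le ⟨_, rfl⟩, smul_mem_piSet hM.le ⟨_, rfl⟩, (hself hr).1,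
    (hself hr').1, (hself hr).2, (hself hr').2, ?_⟩
  rw [eq_sub_iff_add_eq]
  refine Unitization.inr_injective (R := ℝ) ?_
  have := prod_add_smul_eq (u : Unitization ℝ B) (g : Unitization ℝ B) hpoly
  rw [Unitization.inr_add, Unitization.inr_smul, Unitization.inr_smul, inr_mulProd, inr_mulProd,
    FiniteElementsPaper.mpow, inr_mulProd]
  simpa using this.symm

/-- In a semiprime `f`-algebra a product of positive elements may be replaced, as a majorant
among the `p`-fold products, by a power of a lower bound of its factors. -/
lemma exists_majorant_root (hB : IsSemiprime B) {w : B} (hw : w ∈ piSet B (q + 2))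
    (hw0 : 0 ≤ w) : ∃ W z : B, 0 ≤ W ∧ 0 ≤ z ∧ w ≤ mpow W (q + 2) ∧ mpow z (q + 2) ≤ w ∧
      ∀ k : B, IsMajorantIn (piSet B (q + 2)) w k →
        ∀ x : B, 0 ≤ x → ∃ c : ℝ, 0 < c ∧ Perp (x - c • z)⁺ |k| := by
  obtain ⟨φ, rfl⟩ := hw
  obtain ⟨W, hW, hφW⟩ := exists_le_of_family φ
  obtain ⟨z, hz, hzφ, hinf⟩ := exists_lowerBound (fun i => |φ i|) fun i => abs_nonneg _
  have e := abs_mulProd φ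
  rw [abs_of_nonneg hw0] at e
  have hwW : mulProd (q + 2) φ ≤ mpow W (q + 2) := by
    rw [e]; exact mulProd_le_mulProd (fun i => abs_nonneg _) hφW
  refine ⟨W, z, hW, hz, hwW, ?_, fun k hk x hx => ?_⟩
  · rw [e]; exact mulProd_le_mulProd (fun _ => hz) hzφ
  rw [isMajorantIn_iff hw0] at hk
  obtain ⟨c, hc, H⟩ := hk _ (mpow_mem_piSet W _)
  obtain ⟨d, hd, H'⟩ := hk _ (mpow_mem_piSet x _)
  rw [abs_of_nonneg (mpow_nonneg hW)] at H
  rw [abs_of_nonneg (mpow_nonneg hx)] at H'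
  have h1 : Perp (W - c • z)⁺ |k| := by
    refine hinf W |k| c hc fun i => ?_
    exact Perp.of_mpow_sub_mulProd hB hc.le (fun i => abs_nonneg (φ i)) hφW (e ▸ H) i
  have h2 : Perp (x - (max d 1) • W)⁺ |k| := by
    have hm : d ≤ (max d 1) ^ (q + 2) :=
      (le_max_left d 1).trans (le_self_pow₀ (le_max_right d 1) (by omega))
    refine Perp.of_mpow_sub_mpow (q := q + 1) hB ?_ (smul_nonneg (hd.le.trans (le_max_left _ _)) hW)
    rw [mpow_smul]
    exact H'.posPart_sub_mono le_rfl ((smul_le_smul_of_nonneg_left hwW hd.le).trans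
      (smul_le_smul_of_nonneg_right hm (mpow_nonneg hW)))
  have hm0 : 0 < max d 1 := hd.trans_le (le_max_left _ _)
  obtain ⟨N, hN⟩ := exists_nat_ge (max d 1)
  refine ⟨max d 1 * c, mul_pos hm0 hc, (h2.add_left (h1.nsmul_left N)).mono_left
    (posPart_nonneg _) (sup_le ?_ (h2.add_left (h1.nsmul_left N)).1)⟩
  have h3 : max d 1 • (W - c • z) ≤ N • (W - c • z)⁺ := by
    rw [← Nat.cast_smul_eq_nsmul ℝ]
    exact (smul_le_smul_of_nonneg_left (le_posPart _) hm0.le).trans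
      (smul_le_smul_of_nonneg_right hN (posPart_nonneg _))
  calc x - (max d 1 * c) • z = (x - max d 1 • W) + max d 1 • (W - c • z) := by
        rw [smul_sub, smul_smul]; abel
    _ ≤ _ := add_le_add (le_posPart _) h3

lemma IsTotallyFiniteEltIn.of_mpow (hB : IsSemiprime B)
    (H : IsTotallyFiniteEltIn (piSet B (q + 2)) (mpow g (q + 2))) : IsTotallyFiniteElt g := by
  obtain ⟨w, hw, hwg, v, hv, hvw⟩ := H
  obtain ⟨_, z, _, hz, _, hzw, Hz⟩ := exists_majorant_root hB hw hwg.1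
  obtain ⟨_, y, _, hy, _, _, Hy⟩ := exists_majorant_root hB hv hvw.1
  refine ⟨z, isMajorant_of_forall_nonneg hz fun x hx => ?_,
    y, isMajorant_of_forall_nonneg hy fun x hx => ?_⟩
  · obtain ⟨c, hc, h⟩ := Hz _ hwg x hx
    rw [abs_mpow] at h
    exact ⟨c, hc, h.of_mpow_right hB (abs_nonneg g)⟩
  · obtain ⟨c, hc, h⟩ := Hy _ hvw x hx
    rw [abs_of_nonneg hwg.1] at h
    rw [abs_of_nonneg hz]
    exact ⟨c, hc, (h.mono_right (mpow_nonneg hz) hzw).of_mpow_right hB hz⟩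

lemma IsSelfMajorizingIn.exists_le_mpow (hB : IsSemiprime B) {s : B}
    (hs : s ∈ piSet B (q + 2)) (hs0 : 0 ≤ s) (H : IsSelfMajorizingIn (piSet B (q + 2)) s) :
    ∃ (z : B) (N : ℕ), 0 ≤ z ∧ IsSelfMajorizing z ∧ s ≤ mpow (N • z) (q + 2) := by
  obtain ⟨W, z, hW, hz, hsW, hzs, Hz⟩ := exists_majorant_root hB hs hs0
  rw [IsSelfMajorizingIn, abs_of_nonneg hs0] at H
  replace Hz := Hz s H
  rw [abs_of_nonneg hs0] at Hz
  obtain ⟨c, -, hp⟩ := Hz W hW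
  obtain ⟨N, hN⟩ := exists_nat_ge c
  have hNz : 0 ≤ N • z := nsmul_nonneg hz N
  refine ⟨z, N, hz, ?_, ?_⟩
  · rw [IsSelfMajorizing, abs_of_nonneg hz]
    refine isMajorant_of_forall_nonneg hz fun x hx => ?_
    obtain ⟨d, hd, h⟩ := Hz x hx
    rw [abs_of_nonneg hz]
    exact ⟨d, hd, (h.mono_right (mpow_nonneg hz) hzs).of_mpow_right hB hz⟩
  · have h1 : Perp (W - N • z)⁺ s := by
      refine hp.posPart_sub_mono le_rfl ?_
      rw [← Nat.cast_smul_eq_nsmul ℝ]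
      exact smul_le_smul_of_nonneg_right hN hz
    have h2 : Perp (s - mpow (N • z) (q + 2))⁺ s :=
      (h1.mpow_sub_mpow hW hNz).posPart_sub_mono hsW le_rfl
    have h3 : (s - mpow (N • z) (q + 2))⁺ ≤ s :=
      sup_le (sub_le_self _ (mpow_nonneg hNz)) hs0
    exact sub_nonpos.1 (posPart_eq_zero.1 (h2.mono_right (posPart_nonneg _) h3).eq_zero)

lemma InPhi3In.of_mpow (hB : IsSemiprime B)
    (H : InPhi3In (piSet B (q + 2)) (mpow g (q + 2))) : InPhi3 g := by
  obtain ⟨s, t, hs, ht, hs0, ht0, hsS, htS, hg⟩ := H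
  obtain ⟨y, m, hy0, hy, hsy⟩ := hsS.exists_le_mpow hB hs hs0
  obtain ⟨z, n, hz0, hz, htz⟩ := htS.exists_le_mpow hB ht ht0
  have hyz : IsSelfMajorizing (y + z) := isSelfMajorizing_iff_univ.2
    ((isSelfMajorizing_iff_univ.1 hy).add (isSelfMajorizing_iff_univ.1 hz) hy0 hz0)
  have hmy : 0 ≤ m • y := nsmul_nonneg hy0 m
  have hnz : 0 ≤ n • z := nsmul_nonneg hz0 n
  have h1 : mpow |g| (q + 2) ≤ mpow (m • y + n • z) (q + 2) := by
    refine le_trans ?_ ((add_le_add hsy htz).trans (mpow_add_mpow_le hmy hnz))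
    rw [← abs_mpow, hg, abs_le', neg_sub]
    exact ⟨(sub_le_self _ ht0).trans (le_add_of_nonneg_right ht0),
      (sub_le_self _ hs0).trans (le_add_of_nonneg_left hs0)⟩
  have h2 : |g| ≤ m • y + n • z := by
    have h3 : Perp (mpow |g| (q + 2) - mpow (m • y + n • z) (q + 2))⁺
        (|g| - (m • y + n • z))⁺ := by
      rw [posPart_eq_zero.2 (sub_nonpos.2 h1)]
      exact ⟨le_rfl, posPart_nonneg _, inf_eq_left.2 (posPart_nonneg _)⟩
    exact sub_nonpos.1 (posPart_eq_zero.1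
      (h3.of_mpow_sub_mpow hB (add_nonneg hmy hnz)).eq_zero)
  refine inPhi3_of_abs_le (N := m + n) hyz (add_nonneg hy0 hz0) (h2.trans ?_)
  rw [smul_add, add_smul, add_smul]
  exact add_le_add (le_add_of_nonneg_right (nsmul_nonneg hy0 n))
    (le_add_of_nonneg_left (nsmul_nonneg hz0 m))

end Powers

/-- In a uniformly complete f-algebra, `g ∈ Φ₂(𝒜)` implies
`g^p ∈ Φ₂(Π_p(𝒜))` and `g ∈ Φ₃(𝒜)` implies `g^p ∈ Φ₃(Π_p(𝒜))`; if moreover the algebra is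
semiprime, then the converse implications hold as well. -/
theorem stmt19 {A : Type*} [Lattice A] [AddCommGroup A] [Module ℝ A] [Mul A]
    (hA : IsFAlgebra A) (huc : UniformlyComplete A) (p : ℕ) (hp : 2 ≤ p) :
    (∀ g : A, IsTotallyFiniteElt g → IsTotallyFiniteEltIn (piSet A p) (mpow g p)) ∧
    (∀ g : A, InPhi3 g → InPhi3In (piSet A p) (mpow g p)) ∧
    (IsSemiprime A →
      (∀ g : A, IsTotallyFiniteEltIn (piSet A p) (mpow g p) → IsTotallyFiniteElt g) ∧
      (∀ g : A, InPhi3In (piSet A p) (mpow g p) → InPhi3 g)) := by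
  let _ : NonUnitalRing A :=
    { ‹AddCommGroup A›, ‹Mul A› with
      left_distrib := hA.left_distrib
      right_distrib := hA.right_distrib
      mul_assoc := hA.mul_assoc
      zero_mul := fun a => by simpa using hA.smul_mul 0 0 a
      mul_zero := fun a => by simpa using hA.mul_smul 0 a 0 }
  have : IsOrderedAddMonoid A :=
    { add_le_add_left := fun a b h c => by
        rw [add_comm a, add_comm b]; exact hA.add_le_add_left a b h c }
  have nonneg_sub {a b : A} (h : a ≤ b) : 0 ≤ b - a := sub_nonneg.2 h
  have : PosMulMono A := ⟨fun c hc a b h => sub_nonneg.1 <| by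
    simpa [mul_sub] using hA.mul_nonneg c (b - a) hc (nonneg_sub h)⟩
  have : MulPosMono A := ⟨fun c hc a b h => sub_nonneg.1 <| by
    simpa [sub_mul] using hA.mul_nonneg (b - a) c (nonneg_sub h) hc⟩
  have : IsFRing A := ⟨hA.f_prop⟩
  have : IsArchimedeanGroup A := ⟨hA.archimedean⟩
  have : IsScalarTower ℝ A A := ⟨hA.smul_mul⟩
  have : SMulCommClass ℝ A A := ⟨fun r a b => (hA.mul_smul r a b).symm⟩
  have : IsOrderedModule ℝ A :=
    { smul_le_smul_of_nonneg_left := fun r hr a b h => hA.smul_le_smul r a b hr h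
      smul_le_smul_of_nonneg_right := fun a ha r s h => sub_nonneg.1 <| by
        rw [← sub_smul]
        simpa using hA.smul_le_smul (s - r) 0 a (sub_nonneg.2 h) ha }
  let _ : NonUnitalCommRing A := { mul_comm := mul_comm_of_isFRing }
  obtain ⟨q, rfl⟩ : ∃ q, p = q + 2 := ⟨p - 2, by omega⟩
  exact ⟨fun g hg => hg.mpow, fun g hg => hg.mpow, fun hB =>
    ⟨fun g hg => hg.of_mpow hB, fun g hg => hg.of_mpow hB⟩⟩

end FiniteElementsPaper
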